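/- Let 𝔻 ⊆ ℝ^m be open, let K be a nonempty compact topological space, and let T : 𝔻 × K → ℂ^{p×q} be a jointly continuous matrix-valued function whose partial differential with respect to the first variable exists at every point of 𝔻 × K and is jointly continuous on 𝔻 × K. Then the function h_+(δ) = max_{ω ∈ K} σ̄(T(δ, ω)) is lower-C¹ at every point of 𝔻, and consequently h_−(δ) = −max_{ω ∈ K} σ̄(T(δ, ω)) is upper-C¹ at every point of 𝔻. -/

import Mathlib

noncomputable section

structure LowerC1Witness (n : ℕ) (f : EuclideanSpace ℝ (Fin n) → ℝ)
    (x₀ : EuclideanSpace ℝ (Fin n)) where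
  K : Type
  [tK : TopologicalSpace K]
  [cK : CompactSpace K]
  [nK : Nonempty K]
  U : Set (EuclideanSpace ℝ (Fin n))
  openU : IsOpen U
  memU : x₀ ∈ U
  F : EuclideanSpace ℝ (Fin n) → K → ℝ
  DF : EuclideanSpace ℝ (Fin n) → K → (EuclideanSpace ℝ (Fin n) →L[ℝ] ℝ)
  contF : ContinuousOn (fun p : EuclideanSpace ℝ (Fin n) × K => F p.1 p.2) (U ×ˢ Set.univ)
  hasDF : ∀ x ∈ U, ∀ y : K, HasFDerivAt (fun x' => F x' y) (DF x y) x
  contDF : ContinuousOn (fun p : EuclideanSpace ℝ (Fin n) × K => DF p.1 p.2) (U ×ˢ Set.univ)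
  isMax : ∀ x ∈ U, IsGreatest (Set.range fun y : K => F x y) (f x)

def LowerC1At (n : ℕ) (f : EuclideanSpace ℝ (Fin n) → ℝ)
    (x₀ : EuclideanSpace ℝ (Fin n)) : Prop :=
  Nonempty (LowerC1Witness n f x₀)

def UpperC1At (n : ℕ) (f : EuclideanSpace ℝ (Fin n) → ℝ)
    (x₀ : EuclideanSpace ℝ (Fin n)) : Prop :=
  LowerC1At n (fun x => -(f x)) x₀

/-- The largest singular value of a complex matrix: the operator norm of the associated
linear map between Euclidean spaces. -/
def sigmaMax {p q : ℕ} (G : Matrix (Fin p) (Fin q) ℂ) : ℝ :=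
  ‖LinearMap.toContinuousLinearMap (Matrix.toEuclideanLin G)‖

/-- The closed unit ball of `ℂⁿ` with its Euclidean norm. -/
abbrev ComplexUnitBall (n : ℕ) : Type :=
  Metric.closedBall (0 : EuclideanSpace ℂ (Fin n)) 1

instance (n : ℕ) : Nonempty (ComplexUnitBall n) :=
  ⟨⟨0, Metric.mem_closedBall_self zero_le_one⟩⟩

/-- The real bilinear form `Re ⟪u, G v⟫`, written through the entries of `G`. -/
def reForm {p q : ℕ} (u : EuclideanSpace ℂ (Fin p)) (v : EuclideanSpace ℂ (Fin q))
    (G : Matrix (Fin p) (Fin q) ℂ) : ℝ :=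
  ∑ i, ∑ j, ((starRingEnd ℂ (u i) * v j) * G i j).re

lemma reForm_eq_re_inner {p q : ℕ} (u : EuclideanSpace ℂ (Fin p)) (v : EuclideanSpace ℂ (Fin q))
    (G : Matrix (Fin p) (Fin q) ℂ) :
    reForm u v G = (inner ℂ u (LinearMap.toContinuousLinearMap (Matrix.toEuclideanLin G) v)).re := by
  simp only [reForm, PiLp.inner_apply, RCLike.inner_apply, LinearMap.coe_toContinuousLinearMap',
    Matrix.toLpLin_apply, Matrix.mulVec, dotProduct, Complex.re_sum, Finset.sum_mul]
  refine Finset.sum_congr rfl fun i _ => Finset.sum_congr rfl fun j _ => ?_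
  congr 1
  ring

lemma reForm_le_sigmaMax {p q : ℕ} {u : EuclideanSpace ℂ (Fin p)} {v : EuclideanSpace ℂ (Fin q)}
    (hu : ‖u‖ ≤ 1) (hv : ‖v‖ ≤ 1) (G : Matrix (Fin p) (Fin q) ℂ) :
    reForm u v G ≤ sigmaMax G := by
  rw [reForm_eq_re_inner, sigmaMax]
  set L := LinearMap.toContinuousLinearMap (Matrix.toEuclideanLin G)
  calc (inner ℂ u (L v)).re ≤ ‖u‖ * ‖L v‖ := re_inner_le_norm (𝕜 := ℂ) u (L v)
    _ ≤ 1 * ‖L v‖ := by gcongr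
    _ = ‖L v‖ := one_mul _
    _ ≤ ‖L‖ := L.unit_le_opNorm v hv

lemma sigmaMax_le_of_reForm_le {p q : ℕ} {G : Matrix (Fin p) (Fin q) ℂ} {M : ℝ}
    (h : ∀ (u : EuclideanSpace ℂ (Fin p)) (v : EuclideanSpace ℂ (Fin q)),
      ‖u‖ ≤ 1 → ‖v‖ ≤ 1 → reForm u v G ≤ M) : sigmaMax G ≤ M := by
  have hM : 0 ≤ M := by simpa [reForm] using h 0 0 (by simp) (by simp)
  rw [sigmaMax]
  set L := LinearMap.toContinuousLinearMap (Matrix.toEuclideanLin G) with hL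
  refine ContinuousLinearMap.opNorm_le_of_unit_norm (𝕜 := ℂ) hM fun v hv => ?_
  rcases eq_or_ne (L v) 0 with h0 | h0
  · simpa [h0] using hM
  · have hn : ‖L v‖ ≠ 0 := norm_ne_zero_iff.2 h0
    have hu : ‖((‖L v‖⁻¹ : ℝ) : ℂ) • L v‖ ≤ 1 := by
      simp [norm_smul, hn]
    have key := h _ v hu hv.le
    rw [reForm_eq_re_inner, ← hL, inner_smul_left, inner_self_eq_norm_sq_to_K,
      Complex.conj_ofReal] at key
    change (((‖L v‖⁻¹ : ℝ) : ℂ) * (‖L v‖ : ℂ) ^ 2).re ≤ M at key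
    rw [← Complex.ofReal_pow, ← Complex.ofReal_mul, Complex.ofReal_re] at key
    calc ‖L v‖ = ‖L v‖⁻¹ * ‖L v‖ ^ 2 := by field_simp
      _ ≤ M := key

/-- The derivative of `reForm u v` along a matrix family with entrywise derivatives `A i j`. -/
def reFormDeriv {E : Type*} [NormedAddCommGroup E] [NormedSpace ℝ E] {p q : ℕ}
    (u : EuclideanSpace ℂ (Fin p)) (v : EuclideanSpace ℂ (Fin q))
    (A : Fin p → Fin q → (E →L[ℝ] ℂ)) : E →L[ℝ] ℝ :=
  ∑ i, ∑ j, Complex.reCLM ∘L ((starRingEnd ℂ (u i) * v j) • A i j)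

lemma hasFDerivAt_reForm {E : Type*} [NormedAddCommGroup E] [NormedSpace ℝ E] {p q : ℕ}
    (u : EuclideanSpace ℂ (Fin p)) (v : EuclideanSpace ℂ (Fin q))
    {G : E → Matrix (Fin p) (Fin q) ℂ} {A : Fin p → Fin q → (E →L[ℝ] ℂ)} {x : E}
    (hG : ∀ i j, HasFDerivAt (fun x' => G x' i j) (A i j) x) :
    HasFDerivAt (fun x' => reForm u v (G x')) (reFormDeriv u v A) x :=
  HasFDerivAt.fun_sum fun i _ => HasFDerivAt.fun_sum fun j _ =>
    Complex.reCLM.hasFDerivAt.comp x ((hG i j).const_mul _)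

lemma continuousOn_conj_mul_apply {X : Type*} [TopologicalSpace X] {p q : ℕ} {s : Set X}
    {u : X → EuclideanSpace ℂ (Fin p)} {v : X → EuclideanSpace ℂ (Fin q)}
    (hu : ContinuousOn u s) (hv : ContinuousOn v s) (i : Fin p) (j : Fin q) :
    ContinuousOn (fun x => starRingEnd ℂ (u x i) * v x j) s := by
  have hui : ContinuousOn (fun x => u x i) s := by fun_prop
  have hvj : ContinuousOn (fun x => v x j) s := by fun_prop
  exact (Complex.continuous_conj.comp_continuousOn hui).mul hvj

lemma continuousOn_reForm {X : Type*} [TopologicalSpace X] {p q : ℕ} {s : Set X}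
    {u : X → EuclideanSpace ℂ (Fin p)} {v : X → EuclideanSpace ℂ (Fin q)}
    {G : X → Matrix (Fin p) (Fin q) ℂ} (hu : ContinuousOn u s) (hv : ContinuousOn v s)
    (hG : ∀ i j, ContinuousOn (fun x => G x i j) s) :
    ContinuousOn (fun x => reForm (u x) (v x) (G x)) s :=
  continuousOn_finsetSum _ fun i _ => continuousOn_finsetSum _ fun j _ =>
    Complex.continuous_re.comp_continuousOn
      ((continuousOn_conj_mul_apply hu hv i j).mul (hG i j))

lemma continuousOn_reFormDeriv {X E : Type*} [TopologicalSpace X] [NormedAddCommGroup E]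
    [NormedSpace ℝ E] {p q : ℕ} {s : Set X}
    {u : X → EuclideanSpace ℂ (Fin p)} {v : X → EuclideanSpace ℂ (Fin q)}
    {A : X → Fin p → Fin q → (E →L[ℝ] ℂ)} (hu : ContinuousOn u s) (hv : ContinuousOn v s)
    (hA : ∀ i j, ContinuousOn (fun x => A x i j) s) :
    ContinuousOn (fun x => reFormDeriv (u x) (v x) (A x)) s :=
  continuousOn_finsetSum _ fun i _ => continuousOn_finsetSum _ fun j _ =>
    (ContinuousLinearMap.compL ℝ E ℂ ℝ Complex.reCLM).continuous.comp_continuousOn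
      ((continuousOn_conj_mul_apply hu hv i j).smul (hA i j))

lemma isGreatest_range_reForm {K : Type*} [TopologicalSpace K] [CompactSpace K] [Nonempty K]
    {p q : ℕ} {G : K → Matrix (Fin p) (Fin q) ℂ} (hG : ∀ i j, Continuous fun ω => G ω i j) :
    IsGreatest
      (Set.range fun y : K × ComplexUnitBall p × ComplexUnitBall q =>
        reForm y.2.1.1 y.2.2.1 (G y.1))
      (⨆ ω, sigmaMax (G ω)) := by
  have hu : Continuous fun y : K × ComplexUnitBall p × ComplexUnitBall q => y.2.1.1 := by fun_prop
  have hv : Continuous fun y : K × ComplexUnitBall p × ComplexUnitBall q => y.2.2.1 := by fun_prop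
  obtain ⟨y, -, hy⟩ := isCompact_univ.exists_isMaxOn Set.univ_nonempty
    (continuousOn_reForm hu.continuousOn hv.continuousOn
      fun i j => ((hG i j).comp continuous_fst).continuousOn)
  rw [isMaxOn_univ_iff] at hy
  have hle : ∀ ω, sigmaMax (G ω) ≤ reForm y.2.1.1 y.2.2.1 (G y.1) := fun ω =>
    sigmaMax_le_of_reForm_le fun u v hu hv =>
      hy (ω, ⟨u, mem_closedBall_zero_iff.2 hu⟩, ⟨v, mem_closedBall_zero_iff.2 hv⟩)
  have hbdd : BddAbove (Set.range fun ω => sigmaMax (G ω)) :=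
    ⟨_, Set.forall_mem_range.2 hle⟩
  have hform : ∀ z : K × ComplexUnitBall p × ComplexUnitBall q,
      reForm z.2.1.1 z.2.2.1 (G z.1) ≤ ⨆ ω, sigmaMax (G ω) := fun z =>
    (reForm_le_sigmaMax (mem_closedBall_zero_iff.1 z.2.1.2)
      (mem_closedBall_zero_iff.1 z.2.2.2) _).trans (le_ciSup hbdd z.1)
  exact ⟨⟨y, (hform y).antisymm (ciSup_le hle)⟩, Set.forall_mem_range.2 hform⟩

/-- for a jointly continuous, smoothly parameter-dependent matrix family
`T : 𝔻 × K → ℂ^{p×q}` with `K` compact nonempty, the worst-case largest singular value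
`h₊(δ) = max_{ω ∈ K} σ̄(T(δ, ω))` is lower-C¹ on `𝔻`, hence `h₋ = −h₊` is upper-C¹ on `𝔻`. -/
theorem worstCase_sigmaMax_lowerC1 (m p q : ℕ)
    (D : Set (EuclideanSpace ℝ (Fin m))) (hD : IsOpen D)
    (K : Type) [TopologicalSpace K] [CompactSpace K] [Nonempty K]
    (T : EuclideanSpace ℝ (Fin m) → K → Matrix (Fin p) (Fin q) ℂ)
    (DT : EuclideanSpace ℝ (Fin m) → K → Fin p → Fin q → (EuclideanSpace ℝ (Fin m) →L[ℝ] ℂ))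
    (hT : ∀ i j, ContinuousOn
      (fun pr : EuclideanSpace ℝ (Fin m) × K => T pr.1 pr.2 i j) (D ×ˢ Set.univ))
    (hderiv : ∀ δ ∈ D, ∀ (ω : K) (i : Fin p) (j : Fin q),
      HasFDerivAt (fun δ' => T δ' ω i j) (DT δ ω i j) δ)
    (hDT : ∀ i j, ContinuousOn
      (fun pr : EuclideanSpace ℝ (Fin m) × K => DT pr.1 pr.2 i j) (D ×ˢ Set.univ)) :
    ∀ δ₀ ∈ D,
      LowerC1At m (fun δ => ⨆ ω : K, sigmaMax (T δ ω)) δ₀ ∧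
        UpperC1At m (fun δ => -(⨆ ω : K, sigmaMax (T δ ω))) δ₀ := by
  intro δ₀ hδ₀
  have hlower : LowerC1At m (fun δ => ⨆ ω : K, sigmaMax (T δ ω)) δ₀ := by
    have hproj : ContinuousOn
        (fun pr : EuclideanSpace ℝ (Fin m) × (K × ComplexUnitBall p × ComplexUnitBall q) =>
          (pr.1, pr.2.1)) (D ×ˢ Set.univ) := by fun_prop
    have hmaps : Set.MapsTo
        (fun pr : EuclideanSpace ℝ (Fin m) × (K × ComplexUnitBall p × ComplexUnitBall q) =>
          (pr.1, pr.2.1)) (D ×ˢ Set.univ) (D ×ˢ Set.univ) :=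
      fun pr hpr => ⟨hpr.1, Set.mem_univ _⟩
    have hu : Continuous
        fun pr : EuclideanSpace ℝ (Fin m) × (K × ComplexUnitBall p × ComplexUnitBall q) =>
          pr.2.2.1.1 := by fun_prop
    have hv : Continuous
        fun pr : EuclideanSpace ℝ (Fin m) × (K × ComplexUnitBall p × ComplexUnitBall q) =>
          pr.2.2.2.1 := by fun_prop
    exact ⟨{
      K := K × ComplexUnitBall p × ComplexUnitBall q
      U := D
      openU := hD
      memU := hδ₀
      F := fun δ y => reForm y.2.1.1 y.2.2.1 (T δ y.1)
      DF := fun δ y => reFormDeriv y.2.1.1 y.2.2.1 (DT δ y.1)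
      contF := continuousOn_reForm hu.continuousOn hv.continuousOn
        fun i j => (hT i j).comp hproj hmaps
      hasDF := fun δ hδ y => hasFDerivAt_reForm _ _ (hderiv δ hδ y.1)
      contDF := continuousOn_reFormDeriv hu.continuousOn hv.continuousOn
        fun i j => (hDT i j).comp hproj hmaps
      isMax := fun δ hδ => isGreatest_range_reForm fun i j =>
        (hT i j).comp_continuous (Continuous.prodMk_right δ) fun _ => ⟨hδ, Set.mem_univ _⟩ }⟩
  exact ⟨hlower, by simpa only [UpperC1At, neg_neg] using hlower⟩

end
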